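/- Let ρ be a nontrivial zero of the Riemann zeta function. Then for every real x > 0 and every positive integer l, δ_{l,ρ}(x) = ∫₀^{(l+1/2)/x} 𝔉g_ρ(t) dt. -/

import Mathlib

open MeasureTheory Real Filter

/-- The function `η(x) = 8πx²(πx² − 3/2)e^{−πx²}`. -/
noncomputable def eta (x : ℝ) : ℝ :=
  8 * π * x ^ 2 * (π * x ^ 2 - 3 / 2) * Real.exp (-π * x ^ 2)

/-- `g ρ = Z⁻¹ F_ρ`, given by `g ρ t = ∫₁^∞ η(u·t)·u^{ρ−1} du`. -/
noncomputable def g (ρ : ℂ) (t : ℝ) : ℂ :=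
  ∫ u in Set.Ioi (1 : ℝ), (eta (u * t) : ℂ) * (u : ℂ) ^ (ρ - 1)

/-- `F_ρ x = ∫₁^∞ (Σ_{n≥1} η(n·t·x))·t^{ρ−1} dt`. -/
noncomputable def F (ρ : ℂ) (x : ℝ) : ℂ :=
  ∫ t in Set.Ioi (1 : ℝ), (∑' n : ℕ, (eta (((n : ℝ) + 1) * t * x) : ℂ)) * (t : ℂ) ^ (ρ - 1)

/-- `δ_{l,ρ}(x) = ∫₀^∞ g ρ (x·t)·sin((2l+1)πt)/(πt) dt`. -/
noncomputable def delta (l : ℕ) (ρ : ℂ) (x : ℝ) : ℂ :=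
  ∫ t in Set.Ioi (0 : ℝ),
    g ρ (x * t) * ((Real.sin ((2 * (l : ℝ) + 1) * π * t) / (π * t) : ℝ) : ℂ)

/-- The Fourier transform `𝔉f(y) = ∫_ℝ f(x)·e^{2πixy} dx`. -/
noncomputable def FT (f : ℝ → ℂ) (y : ℝ) : ℂ :=
  ∫ x : ℝ, f x * Complex.exp (((2 * π * x * y : ℝ) : ℂ) * Complex.I)

lemma eta_neg (x : ℝ) : eta (-x) = eta x := by
  simp [eta]

lemma continuous_eta : Continuous eta := by
  unfold eta
  fun_prop

lemma integrable_eta : Integrable eta := by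
  have h4 := integrable_rpow_mul_exp_neg_mul_sq pi_pos (s := 4) (by norm_num)
  have h2 := integrable_rpow_mul_exp_neg_mul_sq pi_pos (s := 2) (by norm_num)
  refine ((h4.const_mul (8 * π ^ 2)).sub (h2.const_mul (12 * π))).congr (ae_of_all _ fun x => ?_)
  have e4 : x ^ (4 : ℝ) = x ^ 4 := mod_cast Real.rpow_natCast x 4
  have e2 : x ^ (2 : ℝ) = x ^ 2 := mod_cast Real.rpow_natCast x 2
  simp only [eta, Pi.sub_apply, e4, e2]
  ring

lemma g_neg (ρ : ℂ) (t : ℝ) : g ρ (-t) = g ρ t := by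
  simp [g, eta_neg]

/-- The kernel defining `g` is absolutely integrable on `(1, ∞) × ℝ`. -/
lemma integrable_g_kernel {ρ : ℂ} (hρ : ρ.re < 1) :
    Integrable (fun p : ℝ × ℝ => (eta (p.1 * p.2) : ℂ) * (p.1 : ℂ) ^ (ρ - 1))
      ((volume.restrict (Set.Ioi 1)).prod volume) := by
  have hmeas : Measurable fun p : ℝ × ℝ => (eta (p.1 * p.2) : ℂ) * (p.1 : ℂ) ^ (ρ - 1) := by
    have := continuous_eta.measurable
    fun_prop
  rw [integrable_prod_iff hmeas.aestronglyMeasurable]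
  constructor
  · filter_upwards [ae_restrict_mem measurableSet_Ioi] with u hu
    have hu0 : u ≠ 0 := (zero_lt_one.trans hu).ne'
    exact ((integrable_eta.comp_mul_left' hu0).ofReal (𝕜 := ℂ)).mul_const _
  · have hpow : IntegrableOn (fun u : ℝ => u ^ (ρ.re - 2)) (Set.Ioi 1) :=
      integrableOn_Ioi_rpow_of_lt (by linarith) one_pos
    refine (hpow.mul_const (∫ t, ‖eta t‖)).congr ?_
    filter_upwards [ae_restrict_mem measurableSet_Ioi] with u hu
    have hu0 : 0 < u := zero_lt_one.trans hu
    simp only [norm_mul, Complex.norm_real, Complex.norm_cpow_eq_rpow_re_of_pos hu0]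
    rw [integral_mul_const, Measure.integral_comp_mul_left (fun t => ‖eta t‖), smul_eq_mul,
      abs_of_pos (inv_pos.2 hu0), show ρ.re - 2 = (ρ - 1).re - 1 by simp; ring,
      Real.rpow_sub_one hu0.ne']
    ring

lemma integrable_g {ρ : ℂ} (hρ : ρ.re < 1) : Integrable (g ρ) :=
  (integrable_g_kernel hρ).integral_prod_right

/-- The Fourier transform of an even integrable function is its cosine transform. -/
lemma FT_eq_integral_cos {f : ℝ → ℂ} (hf : Integrable f) (heven : ∀ s, f (-s) = f s) (y : ℝ) :
    FT f y = ∫ s in Set.Ioi (0 : ℝ), 2 * f s * (Real.cos (2 * π * s * y) : ℂ) := by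
  have hint (y : ℝ) :
      Integrable fun s : ℝ => f s * Complex.exp (((2 * π * s * y : ℝ) : ℂ) * Complex.I) := by
    refine hf.mul_bdd (c := 1) (by fun_prop) (ae_of_all _ fun s => ?_)
    rw [Complex.norm_exp_ofReal_mul_I]
  have hIic : ∫ s in Set.Iic (0 : ℝ), f s * Complex.exp (((2 * π * s * y : ℝ) : ℂ) * Complex.I) =
      ∫ s in Set.Ioi (0 : ℝ), f s * Complex.exp (((2 * π * s * -y : ℝ) : ℂ) * Complex.I) := by
    rw [← neg_zero, ← integral_comp_neg_Ioi, neg_zero]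
    simp [heven]
  rw [FT, ← intervalIntegral.integral_Iic_add_Ioi (hint y).integrableOn (hint y).integrableOn,
    hIic, ← integral_add (hint (-y)).integrableOn (hint y).integrableOn]
  congr with s
  rw [Complex.ofReal_cos, Complex.cos]
  push_cast
  ring_nf

/-- The integral of the Fourier transform of an even integrable function over `[0, A]`. -/
lemma intervalIntegral_FT {f : ℝ → ℂ} (hf : Integrable f) (heven : ∀ s, f (-s) = f s) (A : ℝ) :
    ∫ t in (0 : ℝ)..A, FT f t =
      ∫ s in Set.Ioi (0 : ℝ), f s * ((Real.sin (2 * π * s * A) / (π * s) : ℝ) : ℂ) := by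
  simp only [FT_eq_integral_cos hf heven]
  have hprod : Integrable
      (Function.uncurry fun t s : ℝ => 2 * f s * (Real.cos (2 * π * s * t) : ℂ))
      ((volume.restrict (Set.uIoc 0 A)).prod (volume.restrict (Set.Ioi 0))) := by
    have hconst : Integrable (fun _ : ℝ => (2 : ℂ)) (volume.restrict (Set.uIoc 0 A)) :=
      integrableOn_const measure_Ioc_lt_top.ne
    refine (hconst.mul_prod hf.restrict).mul_bdd (c := 1)
      (g := fun p : ℝ × ℝ => (Real.cos (2 * π * p.2 * p.1) : ℂ))
      (by fun_prop) (ae_of_all _ fun p => ?_)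
    rw [Complex.norm_real]
    exact Real.abs_cos_le_one _
  rw [intervalIntegral_integral_swap hprod]
  refine setIntegral_congr_fun measurableSet_Ioi fun s hs => ?_
  have hs0 : s ≠ 0 := (Set.mem_Ioi.1 hs).ne'
  rw [intervalIntegral.integral_const_mul, intervalIntegral.integral_ofReal,
    intervalIntegral.integral_comp_mul_left _ (by positivity), integral_cos, mul_zero,
    Real.sin_zero, sub_zero, smul_eq_mul]
  push_cast
  field_simp

theorem stmt_14 (ρ : ℂ) (hζ : riemannZeta ρ = 0) (hρ0 : 0 < ρ.re) (hρ1 : ρ.re < 1)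
    (x : ℝ) (hx : 0 < x) (l : ℕ) (hl : 0 < l) :
    delta l ρ x = ∫ t in (0 : ℝ)..(((l : ℝ) + 1 / 2) / x), FT (g ρ) t := by
  rw [intervalIntegral_FT (integrable_g hρ1) (g_neg ρ), delta]
  have hscale := integral_comp_mul_left_Ioi (fun s => g ρ s *
    ((Real.sin (2 * π * s * (((l : ℝ) + 1 / 2) / x)) / (π * s) : ℝ) : ℂ)) 0 hx
  rw [mul_zero, eq_inv_smul_iff₀ hx.ne', ← integral_smul] at hscale
  rw [← hscale]
  refine setIntegral_congr_fun measurableSet_Ioi fun t ht => ?_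
  have ht0 : t ≠ 0 := (Set.mem_Ioi.1 ht).ne'
  have harg : 2 * π * (x * t) * (((l : ℝ) + 1 / 2) / x) = (2 * (l : ℝ) + 1) * π * t := by
    field_simp
  simp only [harg, Complex.real_smul]
  rw [mul_left_comm, ← Complex.ofReal_mul]
  congr 3
  field_simp
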